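/- Under the normalization that the first cutoff is zero, the fitting step of the logit trick recovers the true cutoffs and latent scores exactly: let K ≥ 1 and n ≥ 1, let η*_1 < … < η*_K and η'_1 < … < η'_K be real cutoffs with η*_1 = η'_1 = 0, and let z*_1,…,z*_n, z'_1,…,z'_n ∈ ℝ. If p_k(η', z'_i) = p_k(η*, z*_i) for every i ∈ {1,…,n} and every k ∈ {0,…,K}, then η'_k = η*_k for all k and z'_i = z*_i for all i. -/

import Mathlib

open Finset

/-- The logistic (sigmoid) function `σ(t) = 1 / (1 + e^{-t})`. -/
noncomputable def logisticSigma (t : ℝ) : ℝ := 1 / (1 + Real.exp (-t))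

/-- Ordered-logit probabilities: given cutoffs `α 1 < ⋯ < α K` and a latent score `z`,
`olp K α z k` is `σ(α 1 - z)` for `k = 0`, `1 - σ(α K - z)` for `k = K`, and
`σ(α (k+1) - z) - σ(α k - z)` for `1 ≤ k ≤ K - 1`. -/
noncomputable def olp (K : ℕ) (α : ℕ → ℝ) (z : ℝ) (k : ℕ) : ℝ :=
  if k = 0 then logisticSigma (α 1 - z)
  else if k = K then 1 - logisticSigma (α K - z)
  else logisticSigma (α (k + 1) - z) - logisticSigma (α k - z)

theorem logisticSigma_injective : Function.Injective logisticSigma := by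
  intro s t hst
  simpa [logisticSigma] using hst

/-- The ordered-logit probabilities determine the differences between cutoffs and score. -/
theorem sub_eq_sub_of_olp_eq {K : ℕ} {α β : ℕ → ℝ} {z w : ℝ}
    (h : ∀ k < K, olp K α z k = olp K β w k) :
    ∀ k < K, α (k + 1) - z = β (k + 1) - w := by
  intro k hk
  induction k with
  | zero => exact logisticSigma_injective (by simpa [olp] using h 0 hk)
  | succ k ih =>
    have hprev := ih (by omega)
    have hcur := h (k + 1) hk
    simp only [olp, Nat.succ_ne_zero, hk.ne, if_false, hprev] at hcur
    exact logisticSigma_injective (by linarith)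

/-- Under the normalization that the first cutoff is zero, the fitting step of the logit
trick recovers the true cutoffs and latent scores exactly. -/
theorem orderedLogit_exact_recovery (K n : ℕ) (hK : 1 ≤ K) (hn : 1 ≤ n)
    (ηstar η' : ℕ → ℝ)
    (hηstar : ∀ i, 1 ≤ i → i + 1 ≤ K → ηstar i < ηstar (i + 1))
    (hη' : ∀ i, 1 ≤ i → i + 1 ≤ K → η' i < η' (i + 1))
    (hnorm : ηstar 1 = 0) (hnorm' : η' 1 = 0)
    (zstar z' : Fin n → ℝ)
    (h : ∀ i : Fin n, ∀ k ≤ K, olp K η' (z' i) k = olp K ηstar (zstar i) k) :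
    (∀ k, 1 ≤ k → k ≤ K → η' k = ηstar k) ∧ ∀ i : Fin n, z' i = zstar i := by
  have hsub (i : Fin n) := sub_eq_sub_of_olp_eq fun k hk => h i k hk.le
  have hz (i : Fin n) : z' i = zstar i := by
    have := hsub i 0 hK
    simp only [zero_add, hnorm, hnorm'] at this
    linarith
  refine ⟨fun k hk hkK => ?_, hz⟩
  have hcut := hsub ⟨0, hn⟩ (k - 1) (by omega)
  rw [Nat.sub_add_cancel hk, hz] at hcut
  linarith
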